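/- Let (G, S, t) be a Hexasort instance in which every stack height is at most t, and let c be a color such that S contains at least one color-c stack, the last color-c stack in S has height strictly less than t, and the total height of all color-c stacks in S of height strictly less than t is strictly less than t. Then S is not emptyable on (G, t). -/

import Mathlib

open scoped Classical

namespace Hexasort

/-- A board configuration: each vertex holds either a stack `(color, height)` or nothing. -/
abbrev Config (V C : Type*) := V → Option (C × ℕ)

/-- The everywhere-empty configuration. -/
def emptyConfig (V C : Type*) : Config V C := fun _ => none

/-- The height contributed by a board entry to color `c` (0 if empty or another color). -/
noncomputable def colorHeight {C : Type*} (e : Option (C × ℕ)) (c : C) : ℕ :=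
  match e with
  | none => 0
  | some (c', h) => if c' = c then h else 0

/-- Total height of the color-`c` stacks on the neighbors of `x`. -/
noncomputable def neighborSum {V C : Type*} [Fintype V] (G : SimpleGraph V)
    (δ : Config V C) (c : C) (x : V) : ℕ :=
  ∑ y ∈ Finset.univ.filter (fun y => G.Adj x y), colorHeight (δ y) c

/-- The configuration resulting from placing the stack `s` on the vertex `x`:
all same-colored neighbors are emptied, and `x` gets the merged stack unless
its total height reaches the threshold `t`, in which case `x` becomes empty. -/
noncomputable def place {V C : Type*} [Fintype V] (G : SimpleGraph V) (t : ℕ)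
    (δ : Config V C) (s : C × ℕ) (x : V) : Config V C :=
  fun v =>
    if v = x then
      (if t ≤ s.2 + neighborSum G δ s.1 x then none
       else some (s.1, s.2 + neighborSum G δ s.1 x))
    else if G.Adj x v ∧ (∃ hh, δ v = some (s.1, hh)) then none
    else δ v

/-- Play a sequence of stacks on a sequence of vertices, starting from `δ`. -/
noncomputable def play {V C : Type*} [Fintype V] (G : SimpleGraph V) (t : ℕ) :
    Config V C → List (C × ℕ) → List V → Config V C
  | δ, [], _ => δ
  | δ, _ :: _, [] => δ
  | δ, s :: S, x :: p => play G t (place G t δ s x) S p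

/-- Legality of playing the stacks `S` on the vertices `p`, starting from `δ`:
each stack is placed on a vertex that is empty at that moment. -/
inductive Legal {V C : Type*} [Fintype V] (G : SimpleGraph V) (t : ℕ) :
    Config V C → List (C × ℕ) → List V → Prop
  | nil (δ : Config V C) : Legal G t δ [] []
  | cons {δ : Config V C} (s : C × ℕ) (S : List (C × ℕ)) (x : V) (p : List V) :
      δ x = none → Legal G t (place G t δ s x) S p →
      Legal G t δ (s :: S) (x :: p)

/-- `S` is fittable on `(G, t)`: all stacks can be placed in order. -/
def Fittable {V C : Type*} [Fintype V] (G : SimpleGraph V) (t : ℕ)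
    (S : List (C × ℕ)) : Prop :=
  ∃ p : List V, Legal G t (emptyConfig V C) S p

/-- `S` is emptyable on `(G, t)`: all stacks can be placed in order so that the
final configuration is everywhere empty. -/
def Emptyable {V C : Type*} [Fintype V] (G : SimpleGraph V) (t : ℕ)
    (S : List (C × ℕ)) : Prop :=
  ∃ p : List V, Legal G t (emptyConfig V C) S p ∧
    play G t (emptyConfig V C) S p = emptyConfig V C

end Hexasort

namespace Hexasort

noncomputable def total {V C : Type*} [Fintype V] (δ : Config V C) (c : C) : ℕ :=
  ∑ v, colorHeight (δ v) c

lemma total_place_ne {V C : Type*} [Fintype V] (G : SimpleGraph V) (t : ℕ)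
    (δ : Config V C) (s : C × ℕ) (x : V) (c : C) (hx : δ x = none) (hs : s.1 ≠ c) :
    total (place G t δ s x) c = total δ c := by
  unfold total
  refine Finset.sum_congr rfl fun v _ => ?_
  unfold place
  split_ifs with h1 h2 h3
  · subst h1; rw [hx]
  · subst h1; rw [hx]; simp [colorHeight, hs]
  · obtain ⟨_, hh, he⟩ := h3
    rw [he]; simp [colorHeight, hs]
  · rfl

lemma total_place_big {V C : Type*} [Fintype V] (G : SimpleGraph V) (t : ℕ)
    (δ : Config V C) (s : C × ℕ) (x : V) (c : C) (ht : t ≤ s.2) :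
    total (place G t δ s x) c ≤ total δ c := by
  unfold total
  refine Finset.sum_le_sum fun v _ => ?_
  unfold place
  split_ifs with h1 h2 h3
  · simp [colorHeight]
  · omega
  · simp [colorHeight]
  · exact le_rfl

lemma neighborSum_le {V C : Type*} [Fintype V] (G : SimpleGraph V)
    (δ : Config V C) (c : C) (x : V) : neighborSum G δ c x ≤ total δ c :=
  Finset.sum_le_sum_of_subset (Finset.filter_subset _ _)

lemma total_place_le {V C : Type*} [Fintype V] (G : SimpleGraph V) (t : ℕ)
    (δ : Config V C) (s : C × ℕ) (x : V) :
    total (place G t δ s x) s.1 ≤ total δ s.1 + s.2 := by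
  have h1 : total (place G t δ s x) s.1 ≤
      ∑ v, ((if v = x then s.2 + neighborSum G δ s.1 x else 0) +
        (if ¬ G.Adj x v then colorHeight (δ v) s.1 else 0)) := by
    unfold total
    refine Finset.sum_le_sum fun v _ => ?_
    by_cases hv : v = x
    · subst hv
      simp only [place, if_true]
      split_ifs <;> simp [colorHeight]
    · by_cases ha : G.Adj x v
      · simp only [place, hv, ha, if_false, true_and, not_true_eq_false]
        split_ifs with h
        · simp [colorHeight]
        · rcases hd : δ v with _ | ⟨c', h'⟩
          · simp [colorHeight]
          · have : c' ≠ s.1 := by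
              rintro rfl
              exact h ⟨h', hd⟩
            simp [colorHeight, this]
      · simp [place, hv, ha]
  rw [Finset.sum_add_distrib, ← Finset.sum_filter (fun v => ¬ G.Adj x v)] at h1
  have h2 : neighborSum G δ s.1 x +
      ∑ v ∈ Finset.univ.filter (fun v => ¬ G.Adj x v), colorHeight (δ v) s.1 = total δ s.1 :=
    Finset.sum_filter_add_sum_filter_not _ _ _
  simp only [Finset.sum_ite_eq', Finset.mem_univ, if_true] at h1
  omega

lemma total_place_pos {V C : Type*} [Fintype V] (G : SimpleGraph V) (t : ℕ)
    (δ : Config V C) (s : C × ℕ) (x : V) (h1 : 1 ≤ s.2) (h : total δ s.1 + s.2 < t) :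
    0 < total (place G t δ s x) s.1 := by
  have := neighborSum_le G δ s.1 x
  have h2 : colorHeight (place G t δ s x x) s.1 ≤ total (place G t δ s x) s.1 :=
    Finset.single_le_sum (f := fun v => colorHeight (place G t δ s x v) s.1)
      (fun _ _ => Nat.zero_le _) (Finset.mem_univ x)
  have h3 : ¬ t ≤ s.2 + neighborSum G δ s.1 x := by omega
  have h4 : place G t δ s x x = some (s.1, s.2 + neighborSum G δ s.1 x) := by
    simp only [place, if_true, if_neg h3]
  rw [h4] at h2
  simp only [colorHeight, if_true] at h2
  omega

lemma main {V C : Type*} [Fintype V] (G : SimpleGraph V) (t : ℕ) (c : C)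
    (δ : Config V C) (S : List (C × ℕ)) (p : List V) (hL : Legal G t δ S p)
    (hpos : ∀ s ∈ S, 1 ≤ s.2)
    (hne : S.filter (fun s => s.1 = c) = [] → 0 < total δ c)
    (hlast : ∀ s : C × ℕ, (S.filter (fun s => s.1 = c)).getLast? = some s → s.2 < t)
    (hsum : total δ c + (((S.filter (fun s => s.1 = c)).filter (fun s => s.2 < t)).map
      Prod.snd).sum < t) :
    0 < total (play G t δ S p) c := by
  induction hL with
  | nil δ => simpa [play] using hne
  | @cons δ s S x p hx hL ih =>
    simp only [play]
    have hpos' : ∀ s ∈ S, 1 ≤ s.2 := fun a ha => hpos a (List.mem_cons_of_mem _ ha)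
    have hs1 := hpos s List.mem_cons_self
    by_cases hs : s.1 = c
    · subst hs
      simp only [List.filter_cons, decide_true, if_true] at hne hlast hsum
      have hlast' : ∀ a : C × ℕ,
          (S.filter (fun a => a.1 = s.1)).getLast? = some a → a.2 < t := by
        intro a ha
        apply hlast
        rw [List.getLast?_cons, ha]; rfl
      by_cases hb : s.2 < t
      · simp only [hb, decide_true, if_true, List.map_cons, List.sum_cons] at hsum
        have h1 := total_place_le G t δ s x
        exact ih hpos' (fun _ => total_place_pos G t δ s x hs1 (by omega)) hlast' (by omega)
      · simp only [hb, decide_false] at hsum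
        have h1 := total_place_big G t δ s x s.1 (by omega)
        refine ih hpos' (fun h => ?_) hlast' (lt_of_le_of_lt (Nat.add_le_add_right h1 _) hsum)
        rw [h] at hlast
        exact absurd (hlast s rfl) hb
    · have h1 := total_place_ne G t δ s x c hx hs
      simp only [List.filter_cons, hs, decide_false] at hne hlast hsum
      exact ih hpos' (fun h => h1 ▸ hne h) hlast (h1 ▸ hsum)

/-- if all stack heights are at most `t`, the color `c` occurs in `S`,
the last color-`c` stack has height `< t`, and the color-`c` stacks of height `< t`
have total height `< t`, then `S` is not emptyable. -/
theorem statement_12 {V C : Type*} [Fintype V] (G : SimpleGraph V) (t : ℕ)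
    (ht : 1 ≤ t) (S : List (C × ℕ)) (hpos : ∀ s ∈ S, 1 ≤ s.2)
    (hle : ∀ s ∈ S, s.2 ≤ t) (c : C)
    (hne : S.filter (fun s => s.1 = c) ≠ [])
    (hlast : ∀ s : C × ℕ, (S.filter (fun s => s.1 = c)).getLast? = some s → s.2 < t)
    (hsum : (((S.filter (fun s => s.1 = c)).filter (fun s => s.2 < t)).map
      Prod.snd).sum < t) :
    ¬ Emptyable G t S := by
  rintro ⟨p, hL, hE⟩
  have h0 : total (emptyConfig V C) c = 0 := by simp [total, emptyConfig, colorHeight]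
  have := main G t c _ S p hL hpos (fun h => absurd h hne) hlast (by rw [h0]; omega)
  rw [hE, h0] at this
  exact lt_irrefl _ this


end Hexasort
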